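/- The trigonometric R-matrix R(z) = Σ_i E_ii⊗E_ii + Σ_{i≠j} E_ii⊗E_jj·(z−1)/(q^{−1}z−q) + Σ_{i>j} E_ij⊗E_ij·(q^{−1}−q)/(zq^{−1}−q) + Σ_{i<j} E_ij⊗E_ji·z(q^{−1}−q)/(zq^{−1}−q) satisfies the Yang–Baxter equation R₁₂(z)R₁₃(zw)R₂₃(w) = R₂₃(w)R₁₃(zw)R₁₂(z) on (ℂ^n)⊗³, as an identity of rational functions in z, w. -/

import Mathlib

/-- The trigonometric R-matrix of `U_q(gl(n)-hat)` as a matrix on `ℂ^n ⊗ ℂ^n`: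
`R(z) = Σ_i E_ii⊗E_ii + Σ_{i≠j} E_ii⊗E_jj (z−1)/(q⁻¹z−q)
      + Σ_{i>j} E_ij⊗E_ji (q⁻¹−q)/(zq⁻¹−q) + Σ_{i<j} E_ij⊗E_ji z(q⁻¹−q)/(zq⁻¹−q)`. -/
def Rmat (F : Type*) [Field F] (n : ℕ) (q z : F) :
    Matrix (Fin n × Fin n) (Fin n × Fin n) F := fun p r =>
  (if p = r then (if p.1 = p.2 then 1 else (z - 1) / (q⁻¹ * z - q)) else 0)
  + (if p.1 = r.2 ∧ p.2 = r.1 ∧ p.1 ≠ p.2 then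
      (if p.2 < p.1 then (q⁻¹ - q) / (z * q⁻¹ - q) else z * (q⁻¹ - q) / (z * q⁻¹ - q))
    else 0)

/-- `R` acting on factors 1 and 2 of `(ℂ^n)⊗³`. -/
def R12 (F : Type*) [Field F] (n : ℕ) (q z : F) :
    Matrix (Fin n × Fin n × Fin n) (Fin n × Fin n × Fin n) F := fun p r =>
  Rmat F n q z (p.1, p.2.1) (r.1, r.2.1) * (if p.2.2 = r.2.2 then 1 else 0)

/-- `R` acting on factors 1 and 3 of `(ℂ^n)⊗³`. -/
def R13 (F : Type*) [Field F] (n : ℕ) (q z : F) :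
    Matrix (Fin n × Fin n × Fin n) (Fin n × Fin n × Fin n) F := fun p r =>
  Rmat F n q z (p.1, p.2.2) (r.1, r.2.2) * (if p.2.1 = r.2.1 then 1 else 0)

/-- `R` acting on factors 2 and 3 of `(ℂ^n)⊗³`. -/
def R23 (F : Type*) [Field F] (n : ℕ) (q z : F) :
    Matrix (Fin n × Fin n × Fin n) (Fin n × Fin n × Fin n) F := fun p r =>
  (if p.1 = r.1 then 1 else 0) * Rmat F n q z (p.2.1, p.2.2) (r.2.1, r.2.2)

/-- Diagonal coefficient. -/
def ybD {F : Type*} [Field F] {n : ℕ} (q z : F) (a b : Fin n) : F :=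
  if a = b then 1 else q * (z - 1) / (z - q ^ 2)

/-- Off-diagonal coefficient. -/
def ybO {F : Type*} [Field F] {n : ℕ} (q z : F) (a b : Fin n) : F :=
  if a = b then 0 else
    if b < a then (1 - q ^ 2) / (z - q ^ 2) else z * (1 - q ^ 2) / (z - q ^ 2)

theorem yb_Rmat {F : Type*} [Field F] {n : ℕ} (q z : F) (hq : q ≠ 0)
    (hz : q⁻¹ * z - q ≠ 0) (a b c d : Fin n) :
    Rmat F n q z (a, b) (c, d) = (if c = a then if d = b then ybD q z a b else 0 else 0)
      + (if c = b then if d = a then ybO q z a b else 0 else 0) := by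
  have h1 : q⁻¹ * z - q = (z - q ^ 2) / q := by field_simp
  have h1' : z * q⁻¹ - q = (z - q ^ 2) / q := by field_simp
  have h2 : z - q ^ 2 ≠ 0 := by
    intro h; apply hz; rw [h1, h, zero_div]
  have e1 : (z - 1) / ((z - q ^ 2) / q) = q * (z - 1) / (z - q ^ 2) := by field_simp
  have e2 : (q⁻¹ - q) / ((z - q ^ 2) / q) = (1 - q ^ 2) / (z - q ^ 2) := by field_simp
  have e3 : z * (q⁻¹ - q) / ((z - q ^ 2) / q) = z * (1 - q ^ 2) / (z - q ^ 2) := by field_simp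
  simp only [Rmat, ybD, ybO, h1, h1', e1, e2, e3, Prod.mk.injEq]
  generalize q * (z - 1) / (z - q ^ 2) = A
  generalize (1 - q ^ 2) / (z - q ^ 2) = B
  generalize z * (1 - q ^ 2) / (z - q ^ 2) = C
  congr 1 <;> grind

theorem yb12 {F : Type*} [Field F] {n : ℕ} (q z : F) (hq : q ≠ 0)
    (hz : q⁻¹ * z - q ≠ 0) (f : Fin n × Fin n × Fin n → F) (a b c : Fin n) :
    (R12 F n q z).mulVec f (a, b, c) = ybD q z a b * f (a, b, c) + ybO q z a b * f (b, a, c) := by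
  simp only [Matrix.mulVec, dotProduct, R12, yb_Rmat q z hq hz, Fintype.sum_prod_type]
  simp [add_mul, Finset.sum_add_distrib, ite_mul, mul_ite, Finset.sum_ite_irrel]

theorem yb13 {F : Type*} [Field F] {n : ℕ} (q z : F) (hq : q ≠ 0)
    (hz : q⁻¹ * z - q ≠ 0) (f : Fin n × Fin n × Fin n → F) (a b c : Fin n) :
    (R13 F n q z).mulVec f (a, b, c) = ybD q z a c * f (a, b, c) + ybO q z a c * f (c, b, a) := by
  simp only [Matrix.mulVec, dotProduct, R13, yb_Rmat q z hq hz, Fintype.sum_prod_type]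
  simp [add_mul, Finset.sum_add_distrib, ite_mul, mul_ite, Finset.sum_ite_irrel]

theorem yb23 {F : Type*} [Field F] {n : ℕ} (q z : F) (hq : q ≠ 0)
    (hz : q⁻¹ * z - q ≠ 0) (f : Fin n × Fin n × Fin n → F) (a b c : Fin n) :
    (R23 F n q z).mulVec f (a, b, c) = ybD q z b c * f (a, b, c) + ybO q z b c * f (a, c, b) := by
  simp only [Matrix.mulVec, dotProduct, R23, yb_Rmat q z hq hz, Fintype.sum_prod_type]
  simp [add_mul, Finset.sum_add_distrib, ite_mul, mul_ite, Finset.sum_ite_irrel]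

theorem yb_ne {F : Type*} [Field F] (q z : F) (hq : q ≠ 0)
    (hz : q⁻¹ * z - q ≠ 0) : z - q ^ 2 ≠ 0 := by
  intro h; apply hz
  have h1 : q⁻¹ * z - q = (z - q ^ 2) / q := by field_simp
  rw [h1, h, zero_div]

/-- **Yang–Baxter equation** for the trigonometric R-matrix:
`R₁₂(z) R₁₃(zw) R₂₃(w) = R₂₃(w) R₁₃(zw) R₁₂(z)`, as an identity of rational
functions in `z, w` (stated for any field and any values where the denominators
do not vanish). -/
theorem yang_baxter_equation (F : Type*) [Field F] (n : ℕ) (q z w : F)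
    (hq : q ≠ 0) (hq2 : q ^ 2 ≠ 1)
    (hz : q⁻¹ * z - q ≠ 0) (hzw : q⁻¹ * (z * w) - q ≠ 0) (hw : q⁻¹ * w - q ≠ 0) :
    R12 F n q z * R13 F n q (z * w) * R23 F n q w
      = R23 F n q w * R13 F n q (z * w) * R12 F n q z := by
  apply Matrix.mulVec_injective
  funext f
  funext p
  obtain ⟨a, b, c⟩ := p
  simp only [← Matrix.mulVec_mulVec, yb12 q z hq hz, yb13 q (z * w) hq hzw, yb23 q w hq hw]
  have nz := yb_ne q z hq hz
  have nw := yb_ne q w hq hw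
  have nzw := yb_ne q (z * w) hq hzw
  rcases lt_trichotomy a b with h1 | h1 | h1 <;>
  rcases lt_trichotomy b c with h2 | h2 | h2 <;>
  rcases lt_trichotomy a c with h3 | h3 | h3 <;>
  first
  | (exfalso; order)
  | (try subst h1
     try subst h2
     try subst h3
     simp only [ybD, ybO, *, ne_eq, if_true, if_false, lt_irrefl, not_false_eq_true,
       ne_of_lt, ne_of_gt, not_lt_of_gt]
     try field_simp
     try ring)
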